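/- arXiv:math/0002232 — 3 statements merged into one kernel-verified Lean document; each statement's English description precedes it below -/
import Mathlib

section
/- Let p be an odd prime and let G be a group of order p. Let A be a finite-dimensional division algebra over ℚ with dim_ℚ A ∈ {1, 2, 4}, and assume that if dim_ℚ A = 4 then the center of A is ℚ (so A is either ℚ, a quadratic number field, or a quaternion division algebra over ℚ). Suppose G acts on A by ℚ-algebra automorphisms in such a way that the subalgebra of G-fixed elements is exactly ℚ (the image of ℚ in A). Then A = ℚ, i.e., dim_ℚ A = 1. -/
/-- If an irreducible polynomial kills an endomorphism of a finite-dimensional space, its degree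
divides the dimension: the space is a vector space over the corresponding simple extension. -/
theorem Irreducible.natDegree_dvd_finrank_of_aeval_eq_zero {K V : Type*} [Field K]
    [AddCommGroup V] [Module K V] {q : Polynomial K} (hq : Irreducible q)
    (f : Module.End K V) (hf : Polynomial.aeval f q = 0) :
    q.natDegree ∣ Module.finrank K V := by
  have := Fact.mk hq
  let φ : AdjoinRoot q →ₐ[K] Module.End K V :=
    Ideal.Quotient.liftₐ _ (Polynomial.aeval f) (by
      intro a ha
      obtain ⟨b, rfl⟩ := Ideal.mem_span_singleton.mp ha
      simp [hf])
  let _ : Module (AdjoinRoot q) V := Module.compHom V φ.toRingHom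
  have : IsScalarTower K (AdjoinRoot q) V := ⟨fun r x v => by
    change φ (r • x) v = r • φ x v
    rw [map_smul, LinearMap.smul_apply]⟩
  rw [← Module.finrank_mul_finrank K (AdjoinRoot q) V,
    (AdjoinRoot.powerBasis hq.ne_zero).finrank, AdjoinRoot.powerBasis_dim]
  exact dvd_mul_right _ _

/-- A rational endomorphism `f` with `f ^ p = 1` moves a space of dimension divisible
by `p - 1`. -/
theorem Module.End.sub_one_dvd_finrank_range_sub_one {p : ℕ} (hp : p.Prime) {V : Type*}
    [AddCommGroup V] [Module ℚ V] (f : Module.End ℚ V) (hf : f ^ p = 1) :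
    p - 1 ∣ Module.finrank ℚ (LinearMap.range (f - 1)) := by
  have hstable : ∀ x ∈ LinearMap.range (f - 1), f x ∈ LinearMap.range (f - 1) := by
    rintro _ ⟨y, rfl⟩
    exact ⟨f y, by simp⟩
  have hzero : Polynomial.aeval (f.restrict hstable) (Polynomial.cyclotomic p ℚ) = 0 := by
    have := Fact.mk hp
    have hprod : Polynomial.aeval f (Polynomial.cyclotomic p ℚ) * (f - 1) = 0 := by
      have h := congrArg (Polynomial.aeval f) (Polynomial.cyclotomic_prime_mul_X_sub_one ℚ p)
      simpa [hf] using h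
    have hrestrict : ∀ (n : ℕ) (u : LinearMap.range (f - 1)),
        (((f.restrict hstable) ^ n) u : V) = (f ^ n) u := by
      intro n u
      rw [Module.End.pow_restrict, LinearMap.restrict_apply]
    ext ⟨_, y, rfl⟩
    have h := LinearMap.congr_fun hprod y
    rw [Polynomial.cyclotomic_prime] at h ⊢
    simpa [LinearMap.sum_apply, hrestrict] using h
  have h := (Polynomial.cyclotomic.irreducible_rat hp.pos).natDegree_dvd_finrank_of_aeval_eq_zero
    _ hzero
  rwa [Polynomial.natDegree_cyclotomic, Nat.totient_prime hp] at h


/-- Let `p` be an odd prime and let `G` be a group of order `p`.  Let `A` be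
a finite-dimensional division algebra over `ℚ` with `dim_ℚ A ∈ {1, 2, 4}`, and assume that
if `dim_ℚ A = 4` then the center of `A` is `ℚ`.  Suppose `G` acts on `A` by `ℚ`-algebra
automorphisms in such a way that the subalgebra of `G`-fixed elements is exactly `ℚ`
(the image of `ℚ` in `A`).  Then `A = ℚ`, i.e., `dim_ℚ A = 1`. -/
theorem stmt0 (p : ℕ) (hp : p.Prime) (hodd : Odd p)
    (G : Type*) [Group G] [Fintype G] (hG : Fintype.card G = p)
    (A : Type*) [DivisionRing A] [Algebra ℚ A] [FiniteDimensional ℚ A]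
    (hdim : Module.finrank ℚ A ∈ ({1, 2, 4} : Set ℕ))
    (hcenter : Module.finrank ℚ A = 4 → Subalgebra.center ℚ A = ⊥)
    [MulSemiringAction G A] [SMulCommClass G ℚ A]
    (hfix : ∀ a : A, (∀ g : G, g • a = a) ↔ a ∈ (⊥ : Subalgebra ℚ A)) :
    Module.finrank ℚ A = 1 := by
  have := Fact.mk hp
  have hcyc : IsCyclic G := isCyclic_of_prime_card (p := p) (by rw [Nat.card_eq_fintype_card, hG])
  obtain ⟨g, hg⟩ := hcyc.exists_generator
  let f : Module.End ℚ A := DistribSMul.toLinearMap ℚ A g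
  have hpow : f ^ p = 1 := by
    have h : ∀ (n : ℕ) (a : A), (f ^ n) a = g ^ n • a := by
      intro n
      induction n with
      | zero => simp
      | succ n ih =>
        intro a
        rw [pow_succ', Module.End.mul_apply, ih, pow_succ', mul_smul]
        rfl
    ext a
    rw [h, ← hG, pow_card_eq_one, one_smul, Module.End.one_apply]
  have hker : LinearMap.ker (f - 1) = Subalgebra.toSubmodule (⊥ : Subalgebra ℚ A) := by
    ext a
    rw [Subalgebra.mem_toSubmodule, ← hfix, LinearMap.mem_ker, LinearMap.sub_apply, sub_eq_zero]
    refine ⟨fun ha x => ?_, fun ha => ha g⟩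
    have hle : Subgroup.zpowers g ≤ MulAction.stabilizer G a := by
      rw [Subgroup.zpowers_le]
      exact ha
    exact hle (hg x)
  have hrank := LinearMap.finrank_range_add_finrank_ker (f - 1)
  rw [hker, Subalgebra.finrank_toSubmodule, Subalgebra.finrank_bot] at hrank
  have heven : 2 ∣ Module.finrank ℚ (LinearMap.range (f - 1)) :=
    (hodd.tsub_odd odd_one).two_dvd.trans
      (Module.End.sub_one_dvd_finrank_range_sub_one hp f hpow)
  simp only [Set.mem_insert_iff, Set.mem_singleton_iff] at hdim
  omega
end

section
/- Let D be a division algebra over ℚ with dim_ℚ D = 4 whose center is ℚ (a quaternion division algebra over ℚ). Then for every ℚ-algebra automorphism σ of D there exists an element x ∈ D with x ∉ ℚ (i.e., x not in the image of ℚ in D) such that σ(x) = x. -/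
/-- In a central division algebra, the maps `y ↦ y * b i` attached to a linearly independent
family `b` are left linearly independent over the algebra. -/
theorem eq_zero_of_forall_sum_mul_mul_eq_zero {K D ι : Type*} [Field K] [DivisionRing D]
    [Algebra K D] (hcenter : Subalgebra.center K D = ⊥) {b : ι → D}
    (hb : LinearIndependent K b) (s : Finset ι) (a : ι → D)
    (h : ∀ y, ∑ i ∈ s, a i * y * b i = 0) : ∀ i ∈ s, a i = 0 := by
  classical
  induction s using Finset.induction_on generalizing a with
  | empty => simp
  | insert j s hj ih =>
    simp only [Finset.sum_insert hj] at h
    by_cases haj : a j = 0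
    · simp only [haj, zero_mul, zero_add] at h
      simpa [haj] using ih a h
    exfalso
    have hc : ∀ y, y * b j + ∑ i ∈ s, (a j)⁻¹ * a i * y * b i = 0 := by
      intro y
      have := congrArg ((a j)⁻¹ * ·) (h y)
      simpa [mul_add, Finset.mul_sum, ← mul_assoc, haj] using this
    have hcomm : ∀ i ∈ s, (a j)⁻¹ * a i ∈ Subalgebra.center K D := by
      intro i hi
      rw [Subalgebra.mem_center_iff]
      intro z
      refine (sub_eq_zero.1 (ih (fun i => (a j)⁻¹ * a i * z - z * ((a j)⁻¹ * a i)) ?_ i hi)).symm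
      intro y
      have h₁ := hc (z * y)
      have h₂ := congrArg (z * ·) (hc y)
      simp only [mul_add, Finset.mul_sum, mul_zero, ← mul_assoc] at h₁ h₂
      simp only [sub_mul, Finset.sum_sub_distrib, ← mul_assoc]
      exact sub_eq_zero.2 (add_left_cancel (h₁.trans h₂.symm))
    simp only [hcenter, Algebra.mem_bot, Set.mem_range] at hcomm
    choose! k hk using hcomm
    have hsum : ∑ i ∈ insert j s, (if i = j then 1 else k i) • b i = 0 := by
      rw [Finset.sum_insert hj, if_pos rfl, one_smul, ← hc 1, one_mul]
      congr 1
      refine Finset.sum_congr rfl fun i hi => ?_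
      rw [if_neg (ne_of_mem_of_not_mem hi hj), mul_one, ← hk i hi, Algebra.smul_def]
    simpa using linearIndependent_iff'.1 hb _ _ hsum j (Finset.mem_insert_self j s)

/-- Every linear endomorphism of a finite-dimensional central division algebra is a sum of
two-sided multiplications, whose right factors may be taken from a given basis. -/
theorem exists_eq_sum_mul_mul {K D ι : Type*} [Field K] [DivisionRing D] [Algebra K D]
    [Fintype ι] (hcenter : Subalgebra.center K D = ⊥) (b : Module.Basis ι K D)
    (f : D →ₗ[K] D) : ∃ a : ι → D, ∀ y, f y = ∑ i, a i * y * b i := by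
  have : Module.Finite K D := .of_basis b
  let Φ : (ι → D) →ₗ[K] (D →ₗ[K] D) :=
    { toFun := fun a => ∑ i, LinearMap.mulRight K (b i) ∘ₗ LinearMap.mulLeft K (a i)
      map_add' := fun a a' => by
        ext y
        simp [add_mul, Finset.sum_add_distrib]
      map_smul' := fun c a => by
        ext y
        simp [Finset.smul_sum] }
  have hΦ : ∀ a y, Φ a y = ∑ i, a i * y * b i := fun a y => by simp [Φ]
  have hinj : Function.Injective Φ := by
    refine (injective_iff_map_eq_zero Φ).2 fun a ha => funext fun i => ?_
    refine eq_zero_of_forall_sum_mul_mul_eq_zero hcenter b.linearIndependent Finset.univ a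
      (fun y => ?_) i (Finset.mem_univ i)
    rw [← hΦ, ha, LinearMap.zero_apply]
  have hrank : Module.finrank K (ι → D) = Module.finrank K (D →ₗ[K] D) := by
    rw [Module.finrank_pi_fintype, Module.finrank_linearMap]
    simp [Module.finrank_eq_card_basis b]
  obtain ⟨a, ha⟩ := (LinearMap.injective_iff_surjective_of_finrank_eq_finrank hrank).1 hinj f
  exact ⟨a, fun y => by rw [← ha, hΦ]⟩

/-- **Skolem–Noether** for finite-dimensional central division algebras: every automorphism is
inner. -/
theorem AlgEquiv.exists_ne_zero_forall_mul_eq_mul {K D : Type*} [Field K] [DivisionRing D]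
    [Algebra K D] [Module.Finite K D] (hcenter : Subalgebra.center K D = ⊥) (σ : D ≃ₐ[K] D) :
    ∃ s : D, s ≠ 0 ∧ ∀ x, σ x * s = s * x := by
  let b := Module.finBasis K D
  obtain ⟨a, ha⟩ := exists_eq_sum_mul_mul hcenter b σ.toLinearMap
  simp only [AlgEquiv.toLinearMap_apply] at ha
  have hne : ∃ i, a i ≠ 0 := by
    by_contra! h
    simpa [h] using ha 1
  obtain ⟨i, hi⟩ := hne
  refine ⟨a i, hi, fun x => ?_⟩
  refine (sub_eq_zero.1 (eq_zero_of_forall_sum_mul_mul_eq_zero hcenter b.linearIndependent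
    Finset.univ (fun i => σ x * a i - a i * x) (fun y => ?_) i (Finset.mem_univ i)))
  have h := map_mul σ x y
  rw [ha (x * y), ha y, Finset.mul_sum] at h
  simp only [sub_mul, Finset.sum_sub_distrib]
  simp only [← mul_assoc] at h
  exact sub_eq_zero.2 h.symm

/-- Let `D` be a division algebra over `ℚ` with `dim_ℚ D = 4` whose center
is `ℚ` (a quaternion division algebra over `ℚ`).  Then for every `ℚ`-algebra automorphism
`σ` of `D` there exists an element `x ∈ D` with `x ∉ ℚ` (i.e., `x` not in the image of `ℚ`
in `D`) such that `σ x = x`. -/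
theorem stmt1 (D : Type*) [DivisionRing D] [Algebra ℚ D]
    (hdim : Module.finrank ℚ D = 4)
    (hcenter : Subalgebra.center ℚ D = ⊥)
    (σ : D ≃ₐ[ℚ] D) :
    ∃ x : D, x ∉ (⊥ : Subalgebra ℚ D) ∧ σ x = x := by
  have : Module.Finite ℚ D := Module.finite_of_finrank_pos (by omega)
  obtain ⟨s, hs, hσ⟩ := σ.exists_ne_zero_forall_mul_eq_mul hcenter
  by_cases hsQ : s ∈ (⊥ : Subalgebra ℚ D)
  · have hlt : ∃ x : D, x ∉ (⊥ : Subalgebra ℚ D) := by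
      by_contra! h
      have := Subalgebra.finrank_bot (F := ℚ) (E := D)
      rw [Algebra.eq_top_iff.2 h, subalgebra_top_finrank_eq_submodule_top_finrank,
        finrank_top] at this
      omega
    obtain ⟨x, hx⟩ := hlt
    rw [← hcenter, Subalgebra.mem_center_iff] at hsQ
    exact ⟨x, hx, mul_right_cancel₀ hs ((hσ x).trans (hsQ x).symm)⟩
  · exact ⟨s, hsQ, mul_right_cancel₀ hs (hσ s)⟩
end

section
/- Let p be an odd prime, let ζ be the (p−1)×(p−1) matrix over ℚ whose first row consists entirely of −1's, whose entries immediately below the diagonal equal 1, and all of whose other entries are 0, and let b be the (p−1)×(p−1) matrix with every diagonal entry equal to 2 and every off-diagonal entry equal to 1. Then ζᵀ · b · ζ = b; equivalently, b⁻¹ · ζᵀ · b · ζ is the identity matrix. -/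
theorem sum_fin_ite_val_eq {R : Type*} [AddCommMonoid R] (m j : ℕ) (c : R) :
    (∑ i : Fin m, if (i : ℕ) = j then c else 0) = if j < m then c else 0 := by
  rw [Fin.sum_univ_eq_sum_range (fun i => if i = j then c else 0) m, Finset.sum_ite_eq']
  simp only [Finset.mem_range]

/-- A matrix with first row `-1` and subdiagonal `1` preserves the bilinear form
`I + J`, where `J` is the all-ones matrix. -/
theorem transpose_mul_mul_self_of_neg_one_row_subdiagonal {R : Type*} [CommRing R] {n : ℕ}
    (ζ b : Matrix (Fin n) (Fin n) R)
    (hζ : ∀ i j, ζ i j =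
      if (i : ℕ) = 0 then -1 else if (i : ℕ) = (j : ℕ) + 1 then 1 else 0)
    (hb : ∀ i j, b i j = if i = j then 2 else 1) :
    ζ.transpose * b * ζ = b := by
  obtain _ | m := n
  · exact Subsingleton.elim _ _
  have hcol (j : Fin (m + 1)) : ∑ i, ζ i j = -1 + if (j : ℕ) < m then 1 else 0 := by
    simp [Fin.sum_univ_succ, hζ, sum_fin_ite_val_eq, -Finset.sum_boole]
  have hgram (j k : Fin (m + 1)) :
      ∑ i, ζ i j * ζ i k = 1 + if (j : ℕ) < m then if j = k then 1 else 0 else 0 := by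
    have hterm (i : Fin m) : ζ i.succ j * ζ i.succ k =
        if (i : ℕ) = j then if j = k then 1 else 0 else 0 := by
      simp only [hζ, Fin.val_succ, Fin.ext_iff]
      split_ifs <;> first | omega | simp_all
    simp only [Fin.sum_univ_succ, hterm, sum_fin_ite_val_eq]
    simp [hζ]
  have hb' (i j : Fin (m + 1)) : b i j = (if i = j then 1 else 0) + 1 := by
    rw [hb]
    split_ifs <;> norm_num
  have hentry (j k : Fin (m + 1)) : (ζ.transpose * b * ζ) j k =
      ∑ i, ζ i j * ζ i k + (∑ i, ζ i j) * ∑ i, ζ i k := by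
    simp [Matrix.mul_apply, hb', mul_add, add_mul, Finset.sum_add_distrib, Finset.mul_sum]
  ext j k
  rw [hentry, hgram, hcol, hcol, hb]
  simp only [Fin.ext_iff]
  split_ifs <;> first | omega | norm_num


/-- Let `p` be an odd prime, let `ζ` be the `(p−1)×(p−1)` matrix over `ℚ`
whose first row consists entirely of `−1`'s, whose entries immediately below the diagonal
equal `1`, and all of whose other entries are `0`, and let `b` be the `(p−1)×(p−1)` matrix
with every diagonal entry equal to `2` and every off-diagonal entry equal to `1`.  Then
`ζᵀ * b * ζ = b`. -/
theorem stmt8 (p : ℕ) (hp : p.Prime) (hodd : Odd p)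
    (ζ : Matrix (Fin (p - 1)) (Fin (p - 1)) ℚ)
    (hζ : ∀ i j, ζ i j =
      if (i : ℕ) = 0 then -1 else if (i : ℕ) = (j : ℕ) + 1 then 1 else 0)
    (b : Matrix (Fin (p - 1)) (Fin (p - 1)) ℚ)
    (hb : ∀ i j, b i j = if i = j then 2 else 1) :
    ζ.transpose * b * ζ = b :=
  transpose_mul_mul_self_of_neg_one_row_subdiagonal ζ b hζ hb
end
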